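/- Let C and D be coherent categories, M : C ⥤ D a coherent functor, and (A_x ≤ M x)_{x ∈ C} a family of subobjects. The following are equivalent: (1) the family satisfies the Tarski–Vaught criterion in the stronger sense; (2) the family extends uniquely (as a subobject of M in D^C) to an elementary coherent subfunctor of M, i.e. there exist a coherent functor N : C ⥤ D and an elementary natural transformation α : N ⟶ M whose components are monomorphisms representing the A_x. -/

import Mathlib

open CategoryTheory CategoryTheory.Limits

universe w v u v' u'

namespace PosModel

variable {C : Type u} [Category.{v} C] {D : Type u'} [Category.{v'} D]

/-- A natural transformation is *elementary* if each naturality square at a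
monomorphism is a pullback square. -/
def Elementary {N M : C ⥤ D} (η : N ⟶ M) : Prop :=
  ∀ ⦃a x : C⦄ (i : a ⟶ x), Mono i →
    IsPullback (N.map i) (η.app a) (η.app x) (M.map i)

/-- A functor preserves monomorphisms (formulated explicitly). -/
def PreservesMono (F : C ⥤ D) : Prop :=
  ∀ ⦃X Y : C⦄ (f : X ⟶ Y), Mono f → Mono (F.map f)

/-- The subobject represented by a monomorphism (with an explicit proof of
monicity). -/
noncomputable def mkSub {X A : C} (f : A ⟶ X) (h : Mono f) : Subobject X :=
  haveI := h
  Subobject.mk f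

/-- The image of a subobject under a mono-preserving functor. -/
noncomputable def mapSub (F : C ⥤ D) (h : PreservesMono F) {X : C} (a : Subobject X) :
    Subobject (F.obj X) :=
  mkSub (F.map a.arrow) (h a.arrow inferInstance)

/-- The subobject of a functor `M` represented by a pointwise-mono natural
transformation. -/
noncomputable def natSub {N M : C ⥤ D} (α : N ⟶ M) (h : ∀ x : C, Mono (α.app x)) :
    Subobject M :=
  haveI : ∀ x : C, Mono (α.app x) := h
  haveI : Mono α := NatTrans.mono_of_mono_app α
  Subobject.mk α

/-- The axioms of a *coherent category*: a finitely complete category with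
(pullback-stable) effective epi–mono factorizations, binary unions of
subobjects and a least subobject of every object, both stable under pullback. -/
structure CoherentData (C : Type u) [Category.{v} C] [HasFiniteLimits C] :
    Type (max u v) where
  sup : ∀ {X : C}, Subobject X → Subobject X → Subobject X
  le_sup_left : ∀ {X : C} (a b : Subobject X), a ≤ sup a b
  le_sup_right : ∀ {X : C} (a b : Subobject X), b ≤ sup a b
  sup_le : ∀ {X : C} {a b c : Subobject X}, a ≤ c → b ≤ c → sup a b ≤ c
  bot : ∀ X : C, Subobject X
  bot_le : ∀ {X : C} (a : Subobject X), bot X ≤ a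
  factor : ∀ {X Y : C} (f : X ⟶ Y), ∃ (Z : C) (e : X ⟶ Z) (m : Z ⟶ Y),
    EffectiveEpi e ∧ Mono m ∧ e ≫ m = f
  effectiveEpi_pullback : ∀ {P X Y Z : C} (fst : P ⟶ X) (snd : P ⟶ Y) (f : X ⟶ Z) (g : Y ⟶ Z),
    IsPullback fst snd f g → EffectiveEpi g → EffectiveEpi fst
  sup_pullback : ∀ {X Y : C} (f : X ⟶ Y) (a b : Subobject Y),
    (Subobject.pullback f).obj (sup a b) =
      sup ((Subobject.pullback f).obj a) ((Subobject.pullback f).obj b)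
  bot_pullback : ∀ {X Y : C} (f : X ⟶ Y),
    (Subobject.pullback f).obj (bot Y) = bot X

/-- The image of a subobject along an arbitrary morphism, computed using the
effective epi–mono factorizations of a coherent category. -/
noncomputable def CoherentData.img {C : Type u} [Category.{v} C] [HasFiniteLimits C]
    (hC : CoherentData C) {X Y : C} (f : X ⟶ Y) (a : Subobject X) : Subobject Y :=
  mkSub (hC.factor ((a.arrow : (a : C) ⟶ X) ≫ f)).choose_spec.choose_spec.choose
    (hC.factor ((a.arrow : (a : C) ⟶ X) ≫ f)).choose_spec.choose_spec.choose_spec.2.1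

/-- A functor between coherent categories is *coherent* if it preserves finite
limits, effective epimorphisms, finite unions of subobjects and the least
subobjects. -/
structure IsCoherent {C : Type u} [Category.{v} C] {D : Type u'} [Category.{v'} D]
    [HasFiniteLimits C] [HasFiniteLimits D]
    (hC : CoherentData C) (hD : CoherentData D) (F : C ⥤ D) : Prop where
  presLim : Nonempty (PreservesFiniteLimits F)
  presMono : PreservesMono F
  presEpi : ∀ ⦃X Y : C⦄ (f : X ⟶ Y), EffectiveEpi f → EffectiveEpi (F.map f)
  map_sup : ∀ {X : C} (a b : Subobject X),
    mapSub F presMono (hC.sup a b) = hD.sup (mapSub F presMono a) (mapSub F presMono b)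
  map_bot : ∀ X : C, mapSub F presMono (hC.bot X) = hD.bot (F.obj X)

/-- Two functors are *elementarily equivalent* if they validate the same
inclusions of subobjects. -/
def ElemEquiv [HasFiniteLimits C] [HasFiniteLimits D] (M N : C ⥤ D)
    (hM : PreservesMono M) (hN : PreservesMono N) : Prop :=
  ∀ (x : C) (a b : Subobject x),
    (mapSub M hM a ≤ mapSub M hM b) ↔ (mapSub N hN a ≤ mapSub N hN b)

/-- Membership of an element in a subobject of a set. -/
def memSub {X : Type w} (S : Subobject X) (a : X) : Prop :=
  ∃ b : (S : Type w), S.arrow b = a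

/-- The Tarski–Vaught criterion *in the stronger sense* for a family of
subobjects `A x ≤ M x`: for all `n > 0`, `m ≥ 0` and every subobject `φ` of
`x₀ ⨯ ⋯ ⨯ x_{n-1} ⨯ y₀ ⨯ ⋯ ⨯ y_{m-1}`, intersecting with the pullbacks of the
`A (y j)` and then with the pullbacks of the `A (x i)` does not change the
image in `M y₀ ⨯ ⋯ ⨯ M y_{m-1}`. -/
def TarskiVaughtStrong {C : Type u} [Category.{v} C] {D : Type u'} [Category.{v'} D]
    [HasFiniteLimits C] [HasFiniteLimits D] (hD : CoherentData D)
    (M : C ⥤ D) (hM : PreservesMono M) (A : ∀ x : C, Subobject (M.obj x)) : Prop :=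
  ∀ (n m : ℕ), 0 < n → ∀ (x : Fin n → C) (y : Fin m → C)
    (φ : Subobject ((∏ᶜ x) ⨯ (∏ᶜ y))),
    hD.img (M.map (prod.snd : (∏ᶜ x) ⨯ (∏ᶜ y) ⟶ ∏ᶜ y))
        ((mapSub M hM φ ⊓
            Finset.univ.inf (fun j : Fin m =>
              (Subobject.pullback
                (M.map ((prod.snd : (∏ᶜ x) ⨯ (∏ᶜ y) ⟶ ∏ᶜ y) ≫ Pi.π y j))).obj (A (y j)))) ⊓
          Finset.univ.inf (fun i : Fin n =>
            (Subobject.pullback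
              (M.map ((prod.fst : (∏ᶜ x) ⨯ (∏ᶜ y) ⟶ ∏ᶜ x) ≫ Pi.π x i))).obj (A (x i)))) =
      hD.img (M.map (prod.snd : (∏ᶜ x) ⨯ (∏ᶜ y) ⟶ ∏ᶜ y))
        (mapSub M hM φ ⊓
          Finset.univ.inf (fun j : Fin m =>
            (Subobject.pullback
              (M.map ((prod.snd : (∏ᶜ x) ⨯ (∏ᶜ y) ⟶ ∏ᶜ y) ≫ Pi.π y j))).obj (A (y j))))

/-- The family of subobjects `A x ≤ M x` extends, uniquely as a subobject of `M`
in the functor category `D^C`, to an elementary coherent subfunctor of `M`. -/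
def ExtendsToElementarySubfunctor {C : Type u} [Category.{v} C] {D : Type u'} [Category.{v'} D]
    [HasFiniteLimits C] [HasFiniteLimits D]
    (hC : CoherentData C) (hD : CoherentData D)
    (M : C ⥤ D) (A : ∀ x : C, Subobject (M.obj x)) : Prop :=
  ∃ (N : C ⥤ D) (_ : IsCoherent hC hD N) (α : N ⟶ M) (hm : ∀ x : C, Mono (α.app x)),
    Elementary α ∧ (∀ x : C, mkSub (α.app x) (hm x) = A x) ∧
    ∀ (N' : C ⥤ D) (_ : IsCoherent hC hD N') (α' : N' ⟶ M) (hm' : ∀ x : C, Mono (α'.app x)),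
      Elementary α' → (∀ x : C, mkSub (α'.app x) (hm' x) = A x) →
        natSub α hm = natSub α' hm'

theorem mapSub_factors_iff {F : C ⥤ D} (h : PreservesMono F) {X : C} (a : Subobject X) {Z : D}
    (t : Z ⟶ F.obj X) : (mapSub F h a).Factors t ↔ ∃ k, k ≫ F.map a.arrow = t := Iff.rfl

theorem mapSub_mk_factors {F : C ⥤ D} (h : PreservesMono F) {X Y : C} (g : Y ⟶ X) [Mono g]
    {Z : D} (t : Z ⟶ F.obj Y) : (mapSub F h (Subobject.mk g)).Factors (t ≫ F.map g) :=
  ⟨t ≫ F.map (Subobject.underlyingIso g).inv, by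
    simp [MonoOver.arrow, ← Functor.map_comp]⟩

theorem factors_of_mapSub_mk_factors {F : C ⥤ D} (h : PreservesMono F) {X Y : C} (g : Y ⟶ X)
    [Mono g] {Z : D} {t : Z ⟶ F.obj X} (ht : (mapSub F h (Subobject.mk g)).Factors t) :
    ∃ k, k ≫ F.map g = t := by
  obtain ⟨k, rfl⟩ := (mapSub_factors_iff h _ t).1 ht
  exact ⟨k ≫ F.map (Subobject.underlyingIso g).hom, by simp [← Functor.map_comp]⟩

theorem le_of_forall_factors {X : C} {P Q : Subobject X}
    (h : ∀ (Z : C) (t : Z ⟶ X), P.Factors t → Q.Factors t) : P ≤ Q :=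
  Subobject.le_of_factors (h _ _ P.factors_self)

/-- Factoring through a subobject can be tested after precomposition with an effective
epimorphism. -/
theorem factors_of_effectiveEpi_comp {X Y Z : C} (e : X ⟶ Y) [EffectiveEpi e] (T : Subobject Z)
    (g : Y ⟶ Z) (h : T.Factors (e ≫ g)) : T.Factors g := by
  have sq : CommSq (T.factorThru _ h) e T.arrow g := ⟨by simp⟩
  exact (T.factors_iff g).2 ⟨sq.lift, sq.fac_right⟩

/-- A family of subobjects of `M` closed under the action of morphisms extends to a functor. -/
theorem exists_subfunctor (M : C ⥤ D) (A : ∀ x : C, Subobject (M.obj x))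
    (h : ∀ ⦃a x : C⦄ (f : a ⟶ x), (A x).Factors ((A a).arrow ≫ M.map f)) :
    ∃ (N : C ⥤ D) (α : N ⟶ M) (hα : ∀ x, Mono (α.app x)), ∀ x, mkSub (α.app x) (hα x) = A x :=
  let N : C ⥤ D :=
    { obj := fun x => (A x : D)
      map := fun f => (A _).factorThru _ (h f)
      map_id := fun x => by rw [← cancel_mono (A x).arrow]; simp
      map_comp := fun {x y z} f g => by rw [← cancel_mono (A z).arrow]; simp }
  let α : N ⟶ M :=
    { app := fun x => (A x).arrow
      naturality := fun _ _ f => Subobject.factorThru_arrow _ _ (h f) }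
  ⟨N, α, fun x => (inferInstance : Mono (A x).arrow), fun x => Subobject.mk_arrow (A x)⟩

theorem preservesMono_of_mono_app {N M : C ⥤ D} (hM : PreservesMono M) (α : N ⟶ M)
    (hα : ∀ x, Mono (α.app x)) : PreservesMono N := fun X Y f hf => by
  have := hM f hf
  have := hα X
  have : Mono (N.map f ≫ α.app Y) := by rw [α.naturality]; infer_instance
  exact mono_of_mono _ (α.app Y)

theorem Elementary.mapSub_eq [HasPullbacks D] {N M : C ⥤ D} {α : N ⟶ M} (hα : Elementary α)
    (hN : PreservesMono N) (hM : PreservesMono M) {X : C} (a : Subobject X) :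
    mapSub N hN a = (Subobject.pullback (α.app X)).obj (mapSub M hM a) := by
  have := hN a.arrow inferInstance
  have := hM a.arrow inferInstance
  exact (Subobject.pullback_obj_mk (hα a.arrow inferInstance).flip).symm

theorem factors_iff_of_mkSub_eq {X Y : D} {f : Y ⟶ X} {hf : Mono f} {P : Subobject X}
    (h : mkSub f hf = P) {Z : D} (t : Z ⟶ X) : P.Factors t ↔ ∃ k, k ≫ f = t := by
  rw [← h]; exact Iff.rfl

theorem natSub_le_natSub {N N' M : C ⥤ D} {α : N ⟶ M} {α' : N' ⟶ M} (hα : ∀ x, Mono (α.app x))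
    (hα' : ∀ x, Mono (α'.app x))
    (h : ∀ x, mkSub (α.app x) (hα x) ≤ mkSub (α'.app x) (hα' x)) :
    natSub α hα ≤ natSub α' hα' := by
  have := NatTrans.mono_of_mono_app α
  have := NatTrans.mono_of_mono_app α'
  let β (x : C) : N.obj x ⟶ N'.obj x := Subobject.ofMkLEMk _ _ (h x)
  have hβ (x : C) : β x ≫ α'.app x = α.app x := Subobject.ofMkLEMk_comp (h x)
  refine Subobject.mk_le_mk_of_comm ⟨β, fun x y f => ?_⟩ (by ext x; exact hβ x)
  rw [← cancel_mono (α'.app y)]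
  rw [Category.assoc, hβ, Category.assoc, α'.naturality, reassoc_of% hβ, α.naturality]

section img

variable [HasFiniteLimits D] (hD : CoherentData D)

theorem CoherentData.exists_img_factorization {X Y : D} (f : X ⟶ Y) (a : Subobject X) :
    ∃ e : (a : D) ⟶ (hD.img f a : D), EffectiveEpi e ∧ e ≫ (hD.img f a).arrow = a.arrow ≫ f := by
  have h := (hD.factor ((a.arrow : (a : D) ⟶ X) ≫ f)).choose_spec.choose_spec.choose_spec
  have := h.1
  have := h.2.1
  have key {Z : D} (p : (a : D) ⟶ Z) (m : Z ⟶ Y) [EffectiveEpi p] [Mono m]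
      (hpm : p ≫ m = a.arrow ≫ f) : ∃ e : (a : D) ⟶ (Subobject.mk m : D),
      EffectiveEpi e ∧ e ≫ (Subobject.mk m).arrow = a.arrow ≫ f :=
    ⟨p ≫ (Subobject.underlyingIso m).inv, inferInstance, by simpa using hpm⟩
  exact key _ _ h.2.2

theorem CoherentData.img_le_iff {X Y : D} (f : X ⟶ Y) (a : Subobject X) (b : Subobject Y) :
    hD.img f a ≤ b ↔ a ≤ (Subobject.pullback f).obj b := by
  obtain ⟨e, he, hfac⟩ := hD.exists_img_factorization f a
  constructor
  · intro h
    refine Subobject.le_of_factors ((pullback_factors_iff f b _).2 ?_)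
    rw [← hfac]
    exact Subobject.factors_of_le _ h (Subobject.factors_comp_arrow e)
  · intro h
    refine Subobject.le_of_factors (factors_of_effectiveEpi_comp e b _ ?_)
    rw [hfac]
    exact (pullback_factors_iff f b _).1 (Subobject.factors_of_le _ h a.factors_self)

end img

section Criterion

variable [HasFiniteLimits C] [HasFiniteLimits D] {hD : CoherentData D} {M : C ⥤ D}
  {A : ∀ x : C, Subobject (M.obj x)}

/-- The criterion applied to the subobject of `x ⨯ y₀ ⨯ ⋯ ⨯ y_{m-1}` given by a jointly monic family
`h : a ⟶ x`, `f j : a ⟶ y j`. -/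
theorem TarskiVaughtStrong.factors_of_mono_lift {hM : PreservesMono M}
    (hT : TarskiVaughtStrong hD M hM A) {a x : C} {m : ℕ} {y : Fin m → C} (h : a ⟶ x)
    (f : ∀ j, a ⟶ y j) (hmono : Mono (prod.lift (Pi.lift fun _ : Fin 1 => h) (Pi.lift f)))
    (T : Subobject (M.obj (∏ᶜ y)))
    (hle : ∀ (Z : D) (t : Z ⟶ M.obj a), (A x).Factors (t ≫ M.map h) →
      (∀ j, (A (y j)).Factors (t ≫ M.map (f j))) → T.Factors (t ≫ M.map (Pi.lift f)))
    {Z : D} (t : Z ⟶ M.obj a) (ht : ∀ j, (A (y j)).Factors (t ≫ M.map (f j))) :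
    T.Factors (t ≫ M.map (Pi.lift f)) := by
  have key := hT 1 m one_pos (fun _ => x) y
    (Subobject.mk (prod.lift (Pi.lift fun _ : Fin 1 => h) (Pi.lift f)))
  have hs := ((hD.img_le_iff _ _ _).1 <| key.symm.le.trans <| (hD.img_le_iff _ _ T).2 <|
    le_of_forall_factors fun W r hr => by
      rw [Subobject.inf_factors, Subobject.inf_factors, Subobject.finset_inf_factors,
        Subobject.finset_inf_factors] at hr
      obtain ⟨⟨hr₁, hr₂⟩, hr₃⟩ := hr
      obtain ⟨k, rfl⟩ := factors_of_mapSub_mk_factors hM _ hr₁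
      rw [pullback_factors_iff]
      simp only [pullback_factors_iff, Category.assoc, ← Functor.map_comp,
        prod.lift_fst_assoc, prod.lift_snd_assoc, prod.lift_snd, Pi.lift_π] at hr₂ hr₃ ⊢
      exact hle _ k (hr₃ 0 (Finset.mem_univ _)) fun j => hr₂ j (Finset.mem_univ _))
  have hs' := Subobject.factors_of_le
    (t ≫ M.map (prod.lift (Pi.lift fun _ : Fin 1 => h) (Pi.lift f))) hs (by
      rw [Subobject.inf_factors, Subobject.finset_inf_factors]
      refine ⟨mapSub_mk_factors hM _ t, fun j _ => ?_⟩
      simpa [pullback_factors_iff, ← Functor.map_comp, prod.lift_snd,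
        prod.lift_snd_assoc] using ht j)
  simpa [pullback_factors_iff, ← Functor.map_comp, prod.lift_snd, prod.lift_snd_assoc] using hs'

theorem TarskiVaughtStrong.factors_of_mono_pi_lift {hM : PreservesMono M}
    (hT : TarskiVaughtStrong hD M hM A) {a x : C} {m : ℕ} {y : Fin m → C} (h : a ⟶ x)
    (f : ∀ j, a ⟶ y j) (hmono : Mono (Pi.lift f))
    {Z : D} (t : Z ⟶ M.obj a) (ht : ∀ j, (A (y j)).Factors (t ≫ M.map (f j))) :
    (A x).Factors (t ≫ M.map h) := by
  have := hM _ hmono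
  have hT' := hT.factors_of_mono_lift h f
    (prod.mono_lift_of_mono_right _ _)
    ((Subobject.map (M.map (Pi.lift f))).obj ((Subobject.pullback (M.map h)).obj (A x)))
    (fun W r hr _ => by
      rw [← pullback_factors_iff, Subobject.pullback_map_self]
      exact (pullback_factors_iff _ _ _).2 hr) t ht
  rwa [← pullback_factors_iff, Subobject.pullback_map_self,
    pullback_factors_iff] at hT'

theorem TarskiVaughtStrong.factors_map {hM : PreservesMono M}
    (hT : TarskiVaughtStrong hD M hM A) {a x : C} (h : a ⟶ x) :
    (A x).Factors ((A a).arrow ≫ M.map h) :=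
  hT.factors_of_mono_pi_lift (m := 1) (y := fun _ => a) h (fun _ => 𝟙 a)
    (mono_of_mono_fac (h := 𝟙 a) (Pi.lift_π (fun _ : Fin 1 => 𝟙 a) 0)) _ fun _ => by
      simpa using (A a).factors_self

theorem TarskiVaughtStrong.le_of_effectiveEpi {hM : PreservesMono M}
    (hT : TarskiVaughtStrong hD M hM A) {a y : C} (e : a ⟶ y) (he : EffectiveEpi (M.map e))
    (T : Subobject (M.obj y)) (h : T.Factors ((A a).arrow ≫ M.map e)) : A y ≤ T := by
  have hfac {Z : D} := hT.factors_of_mono_lift (Z := Z) (m := 1) (y := fun _ => y) (𝟙 a)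
    (fun _ => e)
    (@prod.mono_lift_of_mono_left _ _ _ _ _ _ _ _
      (mono_of_mono_fac (h := 𝟙 a) (Pi.lift_π (fun _ : Fin 1 => 𝟙 a) 0)))
    ((Subobject.pullback (M.map (Pi.π _ 0))).obj T)
    (fun W r hr _ => by
      rw [pullback_factors_iff, Category.assoc, ← Functor.map_comp, Pi.lift_π]
      rw [CategoryTheory.Functor.map_id, Category.comp_id] at hr
      rw [← Subobject.factorThru_arrow _ _ hr, Category.assoc]
      exact Subobject.factors_of_factors_right _ h)
  have hp := Subobject.isPullback (M.map e) (A y)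
  have := hD.effectiveEpi_pullback _ _ _ _ hp he
  refine Subobject.le_of_factors
    (factors_of_effectiveEpi_comp (Subobject.pullbackπ (M.map e) (A y)) _ _ ?_)
  rw [hp.w]
  have := hfac ((Subobject.pullback (M.map e)).obj (A y)).arrow fun _ => by
    rw [← hp.w]; exact Subobject.factors_comp_arrow _
  rwa [pullback_factors_iff, Category.assoc, ← Functor.map_comp, Pi.lift_π] at this

section Subfunctor

variable {N : C ⥤ D} {α : N ⟶ M} {hα : ∀ x, Mono (α.app x)}

theorem TarskiVaughtStrong.preservesFiniteLimits {hM : PreservesMono M}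
    (hT : TarskiVaughtStrong hD M hM A) (hA : ∀ x, mkSub (α.app x) (hα x) = A x)
    [PreservesFiniteLimits M] : PreservesFiniteLimits N where
  preservesFiniteLimits J _ _ := ⟨fun {K} => ⟨fun {c} hc => by
    let hc' := isLimitOfPreserves M hc
    let s' (s : Cone (K ⋙ N)) := (Cone.postcompose (Functor.whiskerLeft K α)).obj s
    have hs (s : Cone (K ⋙ N)) (j : J) : hc'.lift (s' s) ≫ M.map (c.π.app j) =
        s.π.app j ≫ α.app (K.obj j) := hc'.fac (s' s) j
    have hfac (s : Cone (K ⋙ N)) : ∃ k : s.pt ⟶ N.obj c.pt, k ≫ α.app c.pt = hc'.lift (s' s) := by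
      let φ := (Fintype.equivFin J).symm
      have := hT.factors_of_mono_pi_lift (𝟙 c.pt) (fun j => c.π.app (φ j))
        ⟨fun u v huv => hc.hom_ext fun j => by
          obtain ⟨i, rfl⟩ := φ.surjective j
          simpa using huv =≫ Pi.π _ i⟩ (hc'.lift (s' s)) fun j =>
            (factors_iff_of_mkSub_eq (hA _) _).2 ⟨_, (hs s _).symm⟩
      rw [CategoryTheory.Functor.map_id, Category.comp_id] at this
      exact (factors_iff_of_mkSub_eq (hA _) _).1 this
    choose k hk using hfac
    refine ⟨⟨k, fun s j => ?_, fun s t ht => ?_⟩⟩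
    · have := hα (K.obj j)
      refine (cancel_mono (α.app (K.obj j))).1 ?_
      change (k s ≫ N.map (c.π.app j)) ≫ _ = _
      rw [Category.assoc, α.naturality, reassoc_of% hk, hs]
    · have := hα c.pt
      refine (cancel_mono (α.app c.pt)).1 ((hc'.hom_ext fun j => ?_).trans (hk s).symm)
      refine Eq.trans ?_ (hs s j).symm
      rw [← ht j]
      change (t ≫ α.app c.pt) ≫ M.map (c.π.app j) = (t ≫ N.map (c.π.app j)) ≫ _
      rw [Category.assoc, Category.assoc, α.naturality]⟩⟩

theorem TarskiVaughtStrong.elementary {hM : PreservesMono M}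
    (hT : TarskiVaughtStrong hD M hM A) (hA : ∀ x, mkSub (α.app x) (hα x) = A x) :
    Elementary α := fun a x i hi => by
  have hfac (s : PullbackCone (α.app x) (M.map i)) : ∃ k, k ≫ α.app a = s.snd := by
    have := hT.factors_of_mono_pi_lift (m := 1) (y := fun _ => x) (𝟙 a) (fun _ => i)
      (mono_of_mono_fac (h := i) (Pi.lift_π (fun _ : Fin 1 => i) 0)) s.snd fun _ =>
        (factors_iff_of_mkSub_eq (hA _) _).2 ⟨_, s.condition⟩
    rw [CategoryTheory.Functor.map_id, Category.comp_id] at this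
    exact (factors_iff_of_mkSub_eq (hA _) _).1 this
  choose k hk using hfac
  have := hα a
  have := hα x
  refine ⟨⟨α.naturality i⟩, ⟨PullbackCone.IsLimit.mk _ k (fun s => ?_) hk fun s t _ ht => ?_⟩⟩
  · rw [← cancel_mono (α.app x), Category.assoc, α.naturality, reassoc_of% hk, s.condition]
  · rw [← cancel_mono (α.app a), ht, hk]

theorem TarskiVaughtStrong.isCoherent {hC : CoherentData C} (hM : IsCoherent hC hD M)
    (hT : TarskiVaughtStrong hD M hM.presMono A) (hA : ∀ x, mkSub (α.app x) (hα x) = A x) :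
    IsCoherent hC hD N := by
  have hN := preservesMono_of_mono_app hM.presMono α hα
  have hE := hT.elementary hA
  obtain ⟨_⟩ := hM.presLim
  refine ⟨⟨hT.preservesFiniteLimits hA⟩, hN, fun X Y e he => ?_, fun a b => ?_, fun X => ?_⟩
  · obtain ⟨Z, p, m, hp, hm, hpm⟩ := hD.factor (N.map e)
    have := hα Y
    obtain ⟨k, hk⟩ := (factors_iff_of_mkSub_eq (hA X) _).1 (A X).factors_self
    have hle := hT.le_of_effectiveEpi e (hM.presEpi e he) (Subobject.mk (m ≫ α.app Y))
      ((Subobject.mk_factors_iff _ _).2 ⟨k ≫ p, by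
        change (k ≫ p) ≫ m ≫ α.app Y = _
        rw [← hk, Category.assoc, reassoc_of% hpm, α.naturality, Category.assoc]⟩)
    obtain ⟨r : N.obj Y ⟶ Z, hr : r ≫ m ≫ α.app Y = α.app Y⟩ :=
      (Subobject.mk_factors_iff _ _).1 (Subobject.factors_of_le _ hle
      ((factors_iff_of_mkSub_eq (hA Y) _).2 ⟨𝟙 _, Category.id_comp _⟩))
    have hr' : r ≫ m = 𝟙 _ := by
      rw [← cancel_mono (α.app Y), Category.assoc, hr, Category.id_comp]
    have : IsSplitEpi m := ⟨⟨⟨r, hr'⟩⟩⟩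
    have := isIso_of_mono_of_isSplitEpi m
    rw [← hpm]
    infer_instance
  · simp only [hE.mapSub_eq hN hM.presMono, hM.map_sup, hD.sup_pullback]
  · simp only [hE.mapSub_eq hN hM.presMono, hM.map_bot, hD.bot_pullback]

end Subfunctor

/-- The components of an elementary coherent subfunctor satisfy the criterion. -/
theorem tarskiVaughtStrong_of_elementary {hC : CoherentData C} (hM : IsCoherent hC hD M)
    {N : C ⥤ D} (hN : IsCoherent hC hD N) (α : N ⟶ M) (hα : ∀ x, Mono (α.app x))
    (hE : Elementary α) (hA : ∀ x, mkSub (α.app x) (hα x) = A x) :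
    TarskiVaughtStrong hD M hM.presMono A := by
  intro n m _ x y φ
  obtain ⟨_⟩ := hM.presLim
  obtain ⟨_⟩ := hN.presLim
  have hfac {x : C} {Z : D} (t : Z ⟶ M.obj x) : (A x).Factors t ↔ ∃ k, k ≫ α.app x = t :=
    factors_iff_of_mkSub_eq (hA x) t
  refine le_antisymm ((hD.img_le_iff _ _ _).2 (inf_le_left.trans ((hD.img_le_iff _ _ _).1 le_rfl)))
    ((hD.img_le_iff _ _ _).2 ?_)
  set p : (∏ᶜ x) ⨯ (∏ᶜ y) ⟶ ∏ᶜ y := prod.snd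
  obtain ⟨e, he, hep⟩ := hC.exists_img_factorization p φ
  refine le_of_forall_factors fun Z t ht => ?_
  rw [Subobject.inf_factors, Subobject.finset_inf_factors] at ht
  obtain ⟨⟨k : Z ⟶ M.obj (φ : C), hk : k ≫ M.map φ.arrow = t⟩, ht⟩ := ht
  rw [pullback_factors_iff]
  choose r hr using fun j => (hfac _).1 ((pullback_factors_iff _ _ _).1
    (ht j (Finset.mem_univ _)))
  let hNl := isLimitFanMkObjOfIsLimit N _ _ (productIsProduct y)
  let hMl := isLimitFanMkObjOfIsLimit M _ _ (productIsProduct y)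
  have hu : hNl.lift (Fan.mk Z r) ≫ α.app (∏ᶜ y) = t ≫ M.map p := by
    refine hMl.hom_ext fun ⟨j⟩ => ?_
    have h₁ : hNl.lift (Fan.mk Z r) ≫ N.map (Pi.π y j) = r j := hNl.fac (Fan.mk Z r) ⟨j⟩
    have h₂ := hr j
    rw [Functor.map_comp] at h₂
    change (_ ≫ _) ≫ M.map (Pi.π y j) = (_ ≫ _) ≫ M.map (Pi.π y j)
    rw [Category.assoc, ← α.naturality, reassoc_of% h₁, h₂, Category.assoc]
  have hsq := hE (hC.img p φ).arrow inferInstance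
  have hw : hNl.lift (Fan.mk Z r) ≫ α.app (∏ᶜ y) =
      (k ≫ M.map e) ≫ M.map (hC.img p φ).arrow := by
    rw [hu, ← hk, Category.assoc, Category.assoc, ← Functor.map_comp, ← Functor.map_comp, hep]
  rw [← hu, ← hsq.lift_fst _ _ hw, Category.assoc]
  refine Subobject.factors_of_factors_right _ ?_
  have := hN.presEpi e he
  refine factors_of_effectiveEpi_comp (N.map e) _ _ ?_
  rw [← Functor.map_comp_assoc, hep, Functor.map_comp_assoc, α.naturality,
    α.naturality_assoc, ← Category.assoc, ← pullback_factors_iff]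
  refine Subobject.factors_of_le _ ((hD.img_le_iff _ _ _).1 le_rfl) ?_
  rw [Subobject.inf_factors, Subobject.inf_factors, Subobject.finset_inf_factors,
    Subobject.finset_inf_factors]
  refine ⟨⟨⟨α.app _, rfl⟩, fun j _ => ?_⟩, fun i _ => ?_⟩ <;>
  · rw [pullback_factors_iff, hfac, ← α.naturality, Category.assoc, ← α.naturality,
      ← Category.assoc]
    exact ⟨_, rfl⟩

end Criterion

/-- **Tarski–Vaught test (stronger sense).**  For a coherent functor
`M : C ⥤ D` between coherent categories and a family of subobjects `A x ≤ M x`,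
the family satisfies the Tarski–Vaught criterion in the stronger sense iff it
extends (uniquely, as a subobject of `M` in `D^C`) to an elementary coherent
subfunctor of `M`. -/
theorem tarskiVaught_strong_test {C : Type u} [Category.{v} C] {D : Type u'} [Category.{v'} D]
    [HasFiniteLimits C] [HasFiniteLimits D]
    (hC : CoherentData C) (hD : CoherentData D)
    (M : C ⥤ D) (hM : IsCoherent hC hD M) (A : ∀ x : C, Subobject (M.obj x)) :
    TarskiVaughtStrong hD M hM.presMono A ↔
      ExtendsToElementarySubfunctor hC hD M A := by
  refine ⟨fun hT => ?_,
    fun ⟨N, hN, α, hα, hE, hA, _⟩ => tarskiVaughtStrong_of_elementary hM hN α hα hE hA⟩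
  obtain ⟨N, α, hα, hA⟩ := exists_subfunctor M A fun _ _ f => hT.factors_map f
  refine ⟨N, hT.isCoherent hM hA, α, hα, hT.elementary hA, hA, fun N' _ α' hα' _ hA' => ?_⟩
  exact le_antisymm (natSub_le_natSub _ _ fun x => ((hA x).trans (hA' x).symm).le)
    (natSub_le_natSub _ _ fun x => ((hA' x).trans (hA x).symm).le)

end PosModel
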